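/- Comparability of left and right fractional integrals in L²: let a < b be real numbers, let 0 ≤ σ < 1/2, and let v ∈ L²(a,b). Then ‖D_{b−}^{-σ} v‖_{L²(a,b)} ≤ sec(σπ) ‖D_{a+}^{-σ} v‖_{L²(a,b)} and ‖D_{a+}^{-σ} v‖_{L²(a,b)} ≤ sec(σπ) ‖D_{b−}^{-σ} v‖_{L²(a,b)}. -/

import Mathlib

open MeasureTheory Set

/-- Left Riemann–Liouville fractional integral of order `γ` (with base point `a`);
`D_{a+}^{0}` is the identity. -/
noncomputable def rlIntL (a γ : ℝ) (v : ℝ → ℝ) (t : ℝ) : ℝ :=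
  if γ = 0 then v t
  else (Real.Gamma γ)⁻¹ * ∫ s in a..t, (t - s) ^ (γ - 1) * v s

/-- Right Riemann–Liouville fractional integral of order `γ` (with base point `b`);
`D_{b-}^{0}` is the identity. -/
noncomputable def rlIntR (b γ : ℝ) (v : ℝ → ℝ) (t : ℝ) : ℝ :=
  if γ = 0 then v t
  else (Real.Gamma γ)⁻¹ * ∫ s in t..b, (s - t) ^ (γ - 1) * v s


/-- One-sided power kernel. -/
noncomputable def kp (γ x : ℝ) : ℝ := if 0 < x then x ^ (γ - 1) else 0

lemma kp_nonneg (γ x : ℝ) : 0 ≤ kp γ x := by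
  unfold kp; split_ifs with h
  · exact Real.rpow_nonneg h.le _
  · exact le_rfl

lemma kp_pos {γ x : ℝ} (h : 0 < x) : kp γ x = x ^ (γ - 1) := if_pos h
lemma kp_neg {γ x : ℝ} (h : x ≤ 0) : kp γ x = 0 := if_neg h.not_gt

lemma kp_meas (γ : ℝ) : Measurable (kp γ) := by
  unfold kp
  exact Measurable.ite measurableSet_Ioi (by fun_prop) measurable_const

lemma beta_aux {α β : ℝ} (hα : 0 < α) (hβ : 0 < β) :
    IntegrableOn (fun x : ℝ => x ^ (α - 1) * (1 - x) ^ (β - 1)) (Ioo 0 1) ∧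
    ∫ x in Ioo (0:ℝ) 1, x ^ (α - 1) * (1 - x) ^ (β - 1) = ProbabilityTheory.beta α β := by
  have hb := ProbabilityTheory.beta_pos hα hβ
  have h1 := ProbabilityTheory.lintegral_betaPDF_eq_one hα hβ
  rw [ProbabilityTheory.lintegral_betaPDF] at h1
  set g : ℝ → ℝ := fun x => 1 / ProbabilityTheory.beta α β * x ^ (α - 1) * (1 - x) ^ (β - 1)
  have hm : Measurable g := by fun_prop
  have hg0 : 0 ≤ᵐ[volume.restrict (Ioo (0:ℝ) 1)] g := by
    filter_upwards [ae_restrict_mem measurableSet_Ioo] with x hx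
    have h1 : 0 ≤ x ^ (α - 1) := Real.rpow_nonneg hx.1.le _
    have h2 : 0 ≤ (1 - x) ^ (β - 1) := Real.rpow_nonneg (by linarith [hx.2]) _
    simp only [g, Pi.zero_apply]
    positivity
  have hgi : IntegrableOn g (Ioo 0 1) := by
    refine ⟨hm.aestronglyMeasurable, ?_⟩
    rw [hasFiniteIntegral_iff_ofReal hg0, h1]
    simp
  have hgv : ∫ x in Ioo (0:ℝ) 1, g x = 1 := by
    rw [integral_eq_lintegral_of_nonneg_ae hg0 hm.aestronglyMeasurable, h1]; simp
  have he : (fun x : ℝ => x ^ (α - 1) * (1 - x) ^ (β - 1)) =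
      fun x => ProbabilityTheory.beta α β * g x := by
    ext x; simp only [g]; field_simp
  constructor
  · rw [he]; exact hgi.const_mul _
  · rw [he, integral_const_mul, hgv, mul_one]

lemma J1_aux {σ s s' : ℝ} (h0 : 0 < σ) (h1 : σ < 1 / 2) (hs : s < s') :
    Integrable (fun t => kp σ (t - s) * kp σ (t - s')) ∧
    ∫ t, kp σ (t - s) * kp σ (t - s') =
      ProbabilityTheory.beta σ (1 - 2 * σ) * kp (2 * σ) (s' - s) := by
  obtain ⟨hbi, hbv⟩ := beta_aux (α := σ) (β := 1 - 2 * σ) h0 (by linarith)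
  have hd : 0 < s' - s := sub_pos.2 hs
  set d := s' - s with hdd
  let f : ℝ → ℝ := fun x => s' + d * (x / (1 - x))
  let f' : ℝ → ℝ := fun x => d / (1 - x) ^ 2
  have hder : ∀ x ∈ Ioo (0:ℝ) 1, HasDerivWithinAt f (f' x) (Ioo 0 1) x := by
    intro x hx
    have hx1 : 1 - x ≠ 0 := by linarith [hx.2]
    have := ((((hasDerivAt_id x).div ((hasDerivAt_const x (1:ℝ)).sub (hasDerivAt_id x)) hx1).const_mul d).const_add s')
    refine (this.congr_deriv ?_).hasDerivWithinAt
    simp only [f', id, Pi.sub_apply]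
    field_simp
    ring
  have hinj : InjOn f (Ioo 0 1) := by
    intro x hx y hy hxy
    have hx1 : 1 - x ≠ 0 := by linarith [hx.2]
    have hy1 : 1 - y ≠ 0 := by linarith [hy.2]
    simp only [f] at hxy
    have h2 : x / (1 - x) = y / (1 - y) := mul_left_cancel₀ hd.ne' (by linarith)
    rw [div_eq_div_iff hx1 hy1] at h2
    linarith
  have him : f '' (Ioo 0 1) = Ioi s' := by
    ext y
    simp only [mem_image, mem_Ioi, f]
    constructor
    · rintro ⟨x, hx, rfl⟩
      have : 0 < x / (1 - x) := div_pos hx.1 (by linarith [hx.2])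
      have := mul_pos hd this
      linarith
    · intro hy
      have h3 : 0 < y - s := by linarith
      have h4 : 0 < y - s' := by linarith
      have h5 : 1 - (y - s') / (y - s) = d / (y - s) := by
        rw [hdd]; field_simp; ring
      refine ⟨(y - s') / (y - s), ⟨div_pos h4 h3, ?_⟩, ?_⟩
      · rw [div_lt_one h3]; linarith
      · rw [h5]; field_simp; ring
  have hcongr : EqOn (fun x => |f' x| • (kp σ (f x - s) * kp σ (f x - s')))
      (fun x => kp (2 * σ) d * (x ^ (σ - 1) * (1 - x) ^ (1 - 2 * σ - 1))) (Ioo 0 1) := by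
    intro x hx
    have hx0 := hx.1
    have hx1 : 0 < 1 - x := by linarith [hx.2]
    have e1 : f x - s' = d * x * (1 - x)⁻¹ := by simp only [f]; field_simp; ring
    have e2 : f x - s = d * (1 - x)⁻¹ := by
      simp only [f]
      have : s' = s + d := by rw [hdd]; ring
      rw [this]; field_simp; ring
    simp only [smul_eq_mul]
    rw [e1, e2, kp_pos (by positivity), kp_pos (by positivity), kp_pos hd,
      abs_of_pos (by simp only [f']; positivity),
      Real.mul_rpow (by positivity) (by positivity), Real.mul_rpow (by positivity) (by positivity),
      Real.mul_rpow (by positivity) (by positivity)]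
    simp only [f']
    rw [Real.inv_rpow hx1.le, ← Real.rpow_neg hx1.le]
    have p1 : d ^ (2 * σ - 1) = d * (d ^ (σ - 1) * d ^ (σ - 1)) := by
      rw [← Real.rpow_add hd, ← Real.rpow_one_add' hd.le (by linarith)]; congr 1; ring
    have p2 : (1 - x) ^ (1 - 2 * σ - 1) =
        (1 - x) ^ (-(σ - 1)) * (1 - x) ^ (-(σ - 1)) * ((1 - x) ^ 2)⁻¹ := by
      rw [← Real.rpow_add hx1, ← Real.rpow_natCast, ← Real.rpow_neg hx1.le, ← Real.rpow_add hx1]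
      congr 1; push_cast; ring
    rw [p1, p2]
    ring
  have hind : (fun t => kp σ (t - s) * kp σ (t - s')) =
      (Ioi s').indicator (fun t => kp σ (t - s) * kp σ (t - s')) := by
    ext t
    by_cases ht : t ∈ Ioi s'
    · rw [indicator_of_mem ht]
    · rw [indicator_of_notMem ht, kp_neg (x := t - s'), mul_zero]
      simp only [mem_Ioi, not_lt] at ht; linarith
  rw [hind, integrable_indicator_iff measurableSet_Ioi, integral_indicator measurableSet_Ioi, ← him,
    integrableOn_image_iff_integrableOn_abs_deriv_smul measurableSet_Ioo hder hinj,
    integral_image_eq_integral_abs_deriv_smul measurableSet_Ioo hder hinj]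
  rw [integrableOn_congr_fun hcongr measurableSet_Ioo, setIntegral_congr_fun measurableSet_Ioo hcongr,
    integral_const_mul, hbv]
  exact ⟨hbi.const_mul _, mul_comm _ _⟩

lemma J1 {σ s s' : ℝ} (h0 : 0 < σ) (h1 : σ < 1 / 2) (hs : s ≠ s') :
    Integrable (fun t => kp σ (t - s) * kp σ (t - s')) ∧
    ∫ t, kp σ (t - s) * kp σ (t - s') =
      ProbabilityTheory.beta σ (1 - 2 * σ) * (kp (2 * σ) (s' - s) + kp (2 * σ) (s - s')) := by
  rcases lt_or_gt_of_ne hs with h | h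
  · rw [kp_neg (x := s - s') (by linarith), add_zero]
    exact J1_aux h0 h1 h
  · rw [kp_neg (x := s' - s) (by linarith), zero_add]
    simp_rw [mul_comm (kp σ (_ - s))]
    exact J1_aux h0 h1 h

lemma J3 {σ s s' : ℝ} (h0 : 0 < σ) (h1 : σ < 1 / 2) (hs : s ≠ s') :
    Integrable (fun t => kp σ (s - t) * kp σ (s' - t)) ∧
    ∫ t, kp σ (s - t) * kp σ (s' - t) =
      ProbabilityTheory.beta σ (1 - 2 * σ) * (kp (2 * σ) (s' - s) + kp (2 * σ) (s - s')) := by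
  obtain ⟨hi, hv⟩ := J1 (s := -s) (s' := -s') h0 h1 (by simpa using hs)
  have e : (fun t => kp σ (s - t) * kp σ (s' - t)) =
      fun t => (fun t => kp σ (t - -s) * kp σ (t - -s')) (-t) := by
    ext t; simp only; congr 2 <;> ring
  constructor
  · rw [e]; exact hi.comp_neg
  · rw [e, integral_neg_eq_self (fun t => kp σ (t - -s) * kp σ (t - -s')), hv, add_comm]
    congr 3 <;> ring

lemma J2 {σ s s' : ℝ} (h0 : 0 < σ) :
    Integrable (fun t => kp σ (t - s) * kp σ (s' - t)) ∧
    ∫ t, kp σ (t - s) * kp σ (s' - t) =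
      ProbabilityTheory.beta σ σ * kp (2 * σ) (s' - s) := by
  rcases le_or_gt s' s with hs | hs
  · have : (fun t => kp σ (t - s) * kp σ (s' - t)) = fun _ => 0 := by
      ext t
      rcases le_or_gt t s with h | h
      · rw [kp_neg (by linarith), zero_mul]
      · rw [kp_neg (x := s' - t) (by linarith), mul_zero]
    rw [this, kp_neg (x := s' - s) (by linarith)]
    simp
  obtain ⟨hbi, hbv⟩ := beta_aux (α := σ) (β := σ) h0 h0
  have hd : 0 < s' - s := sub_pos.2 hs
  set d := s' - s with hdd
  let f : ℝ → ℝ := fun x => s + d * x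
  let f' : ℝ → ℝ := fun x => d
  have hder : ∀ x ∈ Ioo (0:ℝ) 1, HasDerivWithinAt f (f' x) (Ioo 0 1) x := by
    intro x hx
    have := (((hasDerivAt_id x).const_mul d).const_add s)
    refine (this.congr_deriv ?_).hasDerivWithinAt
    simp [f']
  have hinj : InjOn f (Ioo 0 1) := by
    intro x hx y hy hxy
    simp only [f] at hxy
    exact mul_left_cancel₀ hd.ne' (by linarith)
  have him : f '' (Ioo 0 1) = Ioo s s' := by
    ext y
    simp only [mem_image, mem_Ioo, f]
    constructor
    · rintro ⟨x, hx, rfl⟩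
      have := mul_pos hd hx.1
      have := mul_pos hd (sub_pos.2 hx.2)
      constructor <;> linarith
    · rintro ⟨h2, h3⟩
      refine ⟨(y - s) / d, ⟨div_pos (by linarith) hd, ?_⟩, ?_⟩
      · rw [div_lt_one hd]; linarith
      · field_simp; ring
  have hcongr : EqOn (fun x => |f' x| • (kp σ (f x - s) * kp σ (s' - f x)))
      (fun x => kp (2 * σ) d * (x ^ (σ - 1) * (1 - x) ^ (σ - 1))) (Ioo 0 1) := by
    intro x hx
    have hx0 := hx.1
    have hx1 : 0 < 1 - x := by linarith [hx.2]
    have e1 : f x - s = d * x := by simp only [f]; ring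
    have e2 : s' - f x = d * (1 - x) := by
      simp only [f]
      have : s' = s + d := by rw [hdd]; ring
      rw [this]; ring
    simp only [smul_eq_mul]
    rw [e1, e2, kp_pos (by positivity), kp_pos (by positivity), kp_pos hd,
      abs_of_pos (by simp only [f']; positivity),
      Real.mul_rpow (by positivity) (by positivity), Real.mul_rpow (by positivity) (by positivity)]
    simp only [f']
    have p1 : d ^ (2 * σ - 1) = d * (d ^ (σ - 1) * d ^ (σ - 1)) := by
      rw [← Real.rpow_add hd]
      nth_rewrite 2 [← Real.rpow_one d]
      rw [← Real.rpow_add hd]; congr 1; ring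
    rw [p1]
    ring
  have hind : (fun t => kp σ (t - s) * kp σ (s' - t)) =
      (Ioo s s').indicator (fun t => kp σ (t - s) * kp σ (s' - t)) := by
    ext t
    by_cases ht : t ∈ Ioo s s'
    · rw [indicator_of_mem ht]
    · rw [indicator_of_notMem ht]
      rcases le_or_gt t s with h | h
      · rw [kp_neg (by linarith), zero_mul]
      · have : s' ≤ t := by by_contra h'; exact ht ⟨h, not_le.1 h'⟩
        rw [kp_neg (x := s' - t) (by linarith), mul_zero]
  rw [hind, integrable_indicator_iff measurableSet_Ioo, integral_indicator measurableSet_Ioo, ← him,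
    integrableOn_image_iff_integrableOn_abs_deriv_smul measurableSet_Ioo hder hinj,
    integral_image_eq_integral_abs_deriv_smul measurableSet_Ioo hder hinj]
  rw [integrableOn_congr_fun hcongr measurableSet_Ioo, setIntegral_congr_fun measurableSet_Ioo hcongr,
    integral_const_mul, hbv]
  exact ⟨hbi.const_mul _, mul_comm _ _⟩

lemma beta_rel {σ : ℝ} (h0 : 0 < σ) (h1 : σ < 1 / 2) :
    ProbabilityTheory.beta σ σ =
      2 * Real.cos (σ * Real.pi) * ProbabilityTheory.beta σ (1 - 2 * σ) := by
  unfold ProbabilityTheory.beta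
  have r1 := Real.Gamma_mul_Gamma_one_sub σ
  have r2 := Real.Gamma_mul_Gamma_one_sub (2 * σ)
  have hpi := Real.pi_pos
  have g1 : 0 < Real.Gamma σ := Real.Gamma_pos_of_pos h0
  have g2 : 0 < Real.Gamma (1 - σ) := Real.Gamma_pos_of_pos (by linarith)
  have g3 : 0 < Real.Gamma (2 * σ) := Real.Gamma_pos_of_pos (by linarith)
  have g4 : 0 < Real.Gamma (1 - 2 * σ) := Real.Gamma_pos_of_pos (by linarith)
  have s1 : 0 < Real.sin (σ * Real.pi) := Real.sin_pos_of_pos_of_lt_pi (by positivity) (by nlinarith)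
  have c1 : 0 < Real.cos (σ * Real.pi) := Real.cos_pos_of_mem_Ioo ⟨by nlinarith, by nlinarith⟩
  rw [show Real.pi * (2 * σ) = 2 * (σ * Real.pi) by ring, Real.sin_two_mul] at r2
  rw [show Real.pi * σ = σ * Real.pi by ring] at r1
  rw [show σ + σ = 2 * σ by ring, show σ + (1 - 2 * σ) = 1 - σ by ring]
  have e1 : Real.Gamma (1 - σ) = Real.pi / Real.sin (σ * Real.pi) / Real.Gamma σ := by
    rw [← r1]; field_simp
  have e2 : Real.Gamma (1 - 2 * σ) =
      Real.pi / (2 * Real.sin (σ * Real.pi) * Real.cos (σ * Real.pi)) / Real.Gamma (2 * σ) := by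
    rw [← r2]; field_simp
  rw [e1, e2]
  field_simp

lemma fub {p q : ℝ → ℝ → ℝ} (hp : Measurable (Function.uncurry p))
    (hq : Measurable (Function.uncurry q)) (hp0 : ∀ t s, 0 ≤ p t s) (hq0 : ∀ t s, 0 ≤ q t s)
    {w : ℝ → ℝ} (hw : Measurable w) {J : ℝ × ℝ → ℝ}
    (h : ∀ᵐ z : ℝ × ℝ, Integrable (fun t => p t z.1 * q t z.2) ∧
      ∫ t, p t z.1 * q t z.2 = J z)
    (hJ : Integrable (fun z : ℝ × ℝ => w z.1 * w z.2 * J z)) :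
    Integrable (fun t => (∫ s, p t s * w s) * (∫ s, q t s * w s)) ∧
    ∫ t, (∫ s, p t s * w s) * (∫ s, q t s * w s) = ∫ z : ℝ × ℝ, w z.1 * w z.2 * J z := by
  let H : (ℝ × ℝ) → ℝ → ℝ := fun z t => (p t z.1 * w z.1) * (q t z.2 * w z.2)
  have hHe : ∀ z t, H z t = w z.1 * w z.2 * (p t z.1 * q t z.2) := by
    intro z t; simp only [H]; ring
  have hp' : Measurable (fun x : (ℝ × ℝ) × ℝ => p x.2 x.1.1) :=
    hp.comp (f := fun x : (ℝ × ℝ) × ℝ => (x.2, x.1.1)) (by fun_prop)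
  have hq' : Measurable (fun x : (ℝ × ℝ) × ℝ => q x.2 x.1.2) :=
    hq.comp (f := fun x : (ℝ × ℝ) × ℝ => (x.2, x.1.2)) (by fun_prop)
  have hHm : Measurable (Function.uncurry H) := by
    have : Function.uncurry H = fun x : (ℝ × ℝ) × ℝ =>
      (p x.2 x.1.1 * w x.1.1) * (q x.2 x.1.2 * w x.1.2) := rfl
    rw [this]; fun_prop
  have hHi : Integrable (Function.uncurry H)
      ((volume : Measure (ℝ × ℝ)).prod (volume : Measure ℝ)) := by
    rw [integrable_prod_iff hHm.aestronglyMeasurable]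
    constructor
    · filter_upwards [h] with z hz
      simp only [Function.uncurry_apply_pair, hHe]
      exact hz.1.const_mul _
    · refine hJ.norm.congr ?_
      filter_upwards [h] with z hz
      simp only [Function.uncurry_apply_pair, hHe]
      simp_rw [norm_mul (w z.1 * w z.2)]
      rw [integral_const_mul]
      have : ∀ t, ‖p t z.1 * q t z.2‖ = p t z.1 * q t z.2 := fun t =>
        Real.norm_of_nonneg (mul_nonneg (hp0 _ _) (hq0 _ _))
      simp_rw [this, hz.2]
      have : 0 ≤ J z := by
        rw [← hz.2]; exact integral_nonneg fun t => mul_nonneg (hp0 _ _) (hq0 _ _)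
      rw [Real.norm_of_nonneg this]
  have hin : ∀ t, ∫ z, H z t = (∫ s, p t s * w s) * (∫ s, q t s * w s) := fun t =>
    integral_prod_mul (μ := volume) (ν := volume) (fun s => p t s * w s) (fun s => q t s * w s)
  constructor
  · simp_rw [← hin]
    exact hHi.integral_prod_right
  · simp_rw [← hin]
    rw [← integral_integral_swap hHi]
    refine integral_congr_ae ?_
    filter_upwards [h] with z hz
    simp only [hHe]
    rw [integral_const_mul, hz.2]

lemma Q_int {a b γ : ℝ} (hγ : 0 < γ) {w : ℝ → ℝ} (hw : Measurable w)
    (hw0 : ∀ x, x ∉ Ioo a b → w x = 0) (hw2 : Integrable (fun x => w x ^ 2)) :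
    Integrable (fun z : ℝ × ℝ => w z.1 * w z.2 * kp γ (z.2 - z.1)) := by
  let k : ℝ → ℝ := (Ioc 0 (b - a)).indicator (fun x => x ^ (γ - 1))
  have hk : Integrable k := by
    rw [integrable_indicator_iff measurableSet_Ioc]
    rcases le_or_gt a b with h | h
    · rw [← intervalIntegrable_iff_integrableOn_Ioc_of_le (by linarith)]
      exact intervalIntegral.intervalIntegrable_rpow' (by linarith)
    · rw [Ioc_eq_empty (by linarith)]; exact integrableOn_empty
  have i1 : Integrable (fun z : ℝ × ℝ => w z.2 ^ 2 * k (z.1 - z.2)) := by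
    have := hw2.convolution_integrand (ContinuousLinearMap.mul ℝ ℝ) hk
    simp only [ContinuousLinearMap.mul_apply', neg_sub] at this
    exact this
  have i1' : Integrable (fun z : ℝ × ℝ => w z.1 ^ 2 * k (z.2 - z.1)) := i1.swap
  have i2 : Integrable (fun z : ℝ × ℝ => w z.2 ^ 2 * k (z.2 - z.1)) := by
    have := hw2.convolution_integrand (ContinuousLinearMap.mul ℝ ℝ) hk.comp_neg
    simp only [ContinuousLinearMap.mul_apply', neg_sub] at this
    exact this
  have hkm := kp_meas γ
  refine (i1'.add i2).mono' (by fun_prop) ?_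
  refine Filter.Eventually.of_forall fun z => ?_
  by_cases h1 : z.1 ∈ Ioo a b
  swap
  · have : 0 ≤ k (z.2 - z.1) := indicator_nonneg (fun x hx => Real.rpow_nonneg hx.1.le _) _
    simp [hw0 _ h1]; positivity
  by_cases h2 : z.2 ∈ Ioo a b
  swap
  · have : 0 ≤ k (z.2 - z.1) := indicator_nonneg (fun x hx => Real.rpow_nonneg hx.1.le _) _
    simp [hw0 _ h2]; positivity
  have hkk : k (z.2 - z.1) = kp γ (z.2 - z.1) := by
    simp only [k]
    rcases le_or_gt (z.2 - z.1) 0 with h | h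
    · rw [kp_neg h, indicator_of_notMem]; exact fun h' => absurd h'.1 (not_lt.2 h)
    · rw [kp_pos h, indicator_of_mem]; exact ⟨h, by linarith [h1.1, h2.2]⟩
  have hk0 := kp_nonneg γ (z.2 - z.1)
  simp only [Pi.add_apply, hkk, norm_mul, Real.norm_of_nonneg hk0]
  rw [← add_mul]
  refine mul_le_mul_of_nonneg_right ?_ hk0
  rw [← sq_abs (w z.1), ← sq_abs (w z.2)]
  simp only [Real.norm_eq_abs]
  nlinarith [sq_nonneg (|w z.1| - |w z.2|), sq_nonneg (|w z.1|), sq_nonneg (|w z.2|)]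

lemma diag_ae : ∀ᵐ z : ℝ × ℝ, z.1 ≠ z.2 := by
  have hm : MeasurableSet {z : ℝ × ℝ | z.1 ≠ z.2} :=
    (measurableSet_eq_fun measurable_fst measurable_snd).compl
  refine (Measure.ae_prod_iff_ae_ae (μ := volume) (ν := volume) hm).2 ?_
  refine Filter.Eventually.of_forall fun x => ?_
  filter_upwards [Measure.ae_ne volume x] with y hy
  exact hy.symm

/-- The key identities on the whole line. -/
lemma key {a b σ : ℝ} (h0 : 0 < σ) (h1 : σ < 1 / 2) {w : ℝ → ℝ} (hw : Measurable w)
    (hw0 : ∀ x, x ∉ Ioo a b → w x = 0) (hw2 : Integrable (fun x => w x ^ 2)) :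
    ∃ N : ℝ,
      (Integrable (fun t => (∫ s, kp σ (t - s) * w s) ^ 2) ∧
        ∫ t, (∫ s, kp σ (t - s) * w s) ^ 2 = N) ∧
      (Integrable (fun t => (∫ s, kp σ (s - t) * w s) ^ 2) ∧
        ∫ t, (∫ s, kp σ (s - t) * w s) ^ 2 = N) ∧
      (Integrable (fun t => (∫ s, kp σ (t - s) * w s) * (∫ s, kp σ (s - t) * w s)) ∧
        ∫ t, (∫ s, kp σ (t - s) * w s) * (∫ s, kp σ (s - t) * w s) =
          Real.cos (σ * Real.pi) * N) := by
  have hkm := kp_meas σ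
  have hQ := Q_int (γ := 2 * σ) (by linarith) hw hw0 hw2
  have hQs : Integrable (fun z : ℝ × ℝ => w z.1 * w z.2 * kp (2 * σ) (z.1 - z.2)) := by
    refine hQ.swap.congr (Filter.Eventually.of_forall fun z => ?_)
    simp only [Function.comp, Prod.swap]; ring
  have hQe : ∫ z : ℝ × ℝ, w z.1 * w z.2 * kp (2 * σ) (z.1 - z.2) =
      ∫ z : ℝ × ℝ, w z.1 * w z.2 * kp (2 * σ) (z.2 - z.1) := by
    have := integral_prod_swap (μ := (volume : Measure ℝ)) (ν := (volume : Measure ℝ))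
      (fun z : ℝ × ℝ => w z.1 * w z.2 * kp (2 * σ) (z.2 - z.1))
    simp only [Prod.fst_swap, Prod.snd_swap] at this
    refine Eq.trans ?_ this
    refine integral_congr_ae (Filter.Eventually.of_forall fun z => ?_)
    simp only; ring
  set Q := ∫ z : ℝ × ℝ, w z.1 * w z.2 * kp (2 * σ) (z.2 - z.1) with hQd
  set c := ProbabilityTheory.beta σ (1 - 2 * σ)
  have e1 : (fun z : ℝ × ℝ => w z.1 * w z.2 * (c * (kp (2 * σ) (z.2 - z.1) + kp (2 * σ) (z.1 - z.2))))
      = fun z : ℝ × ℝ => c * (w z.1 * w z.2 * kp (2 * σ) (z.2 - z.1) +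
        w z.1 * w z.2 * kp (2 * σ) (z.1 - z.2)) := by
    ext z; ring
  have e2 : (fun z : ℝ × ℝ => w z.1 * w z.2 * (ProbabilityTheory.beta σ σ * kp (2 * σ) (z.2 - z.1)))
      = fun z : ℝ × ℝ => ProbabilityTheory.beta σ σ * (w z.1 * w z.2 * kp (2 * σ) (z.2 - z.1)) := by
    ext z; ring
  have v1 : ∫ z : ℝ × ℝ, w z.1 * w z.2 *
      (c * (kp (2 * σ) (z.2 - z.1) + kp (2 * σ) (z.1 - z.2))) = 2 * c * Q := by
    rw [e1, integral_const_mul, integral_add hQ hQs, hQe]; ring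
  have i1 : Integrable fun z : ℝ × ℝ => w z.1 * w z.2 *
      (c * (kp (2 * σ) (z.2 - z.1) + kp (2 * σ) (z.1 - z.2))) := by
    rw [e1]; exact (hQ.add hQs).const_mul _
  have v2 : ∫ z : ℝ × ℝ, w z.1 * w z.2 * (ProbabilityTheory.beta σ σ * kp (2 * σ) (z.2 - z.1)) =
      Real.cos (σ * Real.pi) * (2 * c * Q) := by
    rw [e2, integral_const_mul, beta_rel h0 h1]; ring
  have i2 : Integrable fun z : ℝ × ℝ =>
      w z.1 * w z.2 * (ProbabilityTheory.beta σ σ * kp (2 * σ) (z.2 - z.1)) := by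
    rw [e2]; exact hQ.const_mul _
  have mp : Measurable (Function.uncurry fun t s : ℝ => kp σ (t - s)) :=
    hkm.comp (f := fun x : ℝ × ℝ => x.1 - x.2) (by fun_prop)
  have mq : Measurable (Function.uncurry fun t s : ℝ => kp σ (s - t)) :=
    hkm.comp (f := fun x : ℝ × ℝ => x.2 - x.1) (by fun_prop)
  refine ⟨2 * c * Q, ?_, ?_, ?_⟩
  · simp_rw [sq, ← v1]
    refine fub mp mp (fun _ _ => kp_nonneg _ _) (fun _ _ => kp_nonneg _ _) hw ?_ i1
    filter_upwards [diag_ae] with z hz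
    exact J1 h0 h1 hz
  · simp_rw [sq, ← v1]
    refine fub mq mq (fun _ _ => kp_nonneg _ _) (fun _ _ => kp_nonneg _ _) hw ?_ i1
    filter_upwards [diag_ae] with z hz
    exact J3 h0 h1 hz
  · simp_rw [← v2]
    refine fub mp mq (fun _ _ => kp_nonneg _ _) (fun _ _ => kp_nonneg _ _) hw ?_ i2
    exact Filter.Eventually.of_forall fun z => J2 h0

lemma real_ineq {a b c N : ℝ} (hc : 0 < c) {F G : ℝ → ℝ}
    (hF : Integrable (fun t => F t ^ 2)) (hG : Integrable (fun t => G t ^ 2))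
    (hGN : ∫ t, G t ^ 2 = N)
    (hFG : Integrable (fun t => F t * G t)) (hFGN : ∫ t, F t * G t = c * N)
    (hz : ∀ t, t ∉ Ioo a b → F t * G t = 0) :
    ∫ t in Ioo a b, G t ^ 2 ≤ ∫ t in Ioo a b, (c⁻¹ * F t) ^ 2 := by
  have h1 : ∫ t in Ioo a b, F t * G t = c * N := by
    rw [← hFGN]; exact setIntegral_eq_integral_of_forall_compl_eq_zero hz
  have h2 : ∫ t in Ioo a b, G t ^ 2 ≤ N := by
    rw [← hGN]
    exact setIntegral_le_integral hG (Filter.Eventually.of_forall fun t => sq_nonneg _)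
  have h3 : ∫ t in Ioo a b, F t * G t ≤
      ∫ t in Ioo a b, (c / 2 * (c⁻¹ * F t) ^ 2 + c / 2 * G t ^ 2) := by
    have hF' : Integrable (fun t => (c⁻¹ * F t) ^ 2) := by
      simp_rw [mul_pow]; exact hF.const_mul _
    refine integral_mono hFG.integrableOn
      ((hF'.const_mul _).add (hG.const_mul _)).integrableOn fun t => ?_
    have : F t = c * (c⁻¹ * F t) := by field_simp
    simp only
    set x := c⁻¹ * F t
    rw [this]
    nlinarith [mul_nonneg hc.le (sq_nonneg (x - G t))]
  have hF' : Integrable (fun t => (c⁻¹ * F t) ^ 2) := by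
    simp_rw [mul_pow]; exact hF.const_mul _
  rw [integral_add (hF'.const_mul _).integrableOn (hG.const_mul _).integrableOn,
    integral_const_mul, integral_const_mul, h1] at h3
  have h4 : c * ∫ t in Ioo a b, G t ^ 2 ≤ c * N := mul_le_mul_of_nonneg_left h2 hc.le
  have h5 : c * ∫ t in Ioo a b, G t ^ 2 ≤ c * ∫ t in Ioo a b, (c⁻¹ * F t) ^ 2 := by linarith
  exact le_of_mul_le_mul_left h5 hc

lemma eLp_le {μ : Measure ℝ} {f g : ℝ → ℝ} (hf : Integrable (fun t => f t ^ 2) μ)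
    (hg : Integrable (fun t => g t ^ 2) μ) (h : ∫ t, f t ^ 2 ∂μ ≤ ∫ t, g t ^ 2 ∂μ) :
    eLpNorm f 2 μ ≤ eLpNorm g 2 μ := by
  have key : ∀ f : ℝ → ℝ, Integrable (fun t => f t ^ 2) μ →
      eLpNorm f 2 μ = (ENNReal.ofReal (∫ t, f t ^ 2 ∂μ)) ^ (1 / 2 : ℝ) := by
    intro f hf
    rw [eLpNorm_eq_lintegral_rpow_enorm_toReal (by simp) (by simp),
      ofReal_integral_eq_lintegral_ofReal hf (Filter.Eventually.of_forall fun t => sq_nonneg _)]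
    simp only [ENNReal.toReal_ofNat]
    congr 2
    ext t
    rw [Real.enorm_eq_ofReal_abs, ENNReal.ofReal_rpow_of_nonneg (abs_nonneg _) (by norm_num)]
    simp
  rw [key f hf, key g hg]
  gcongr

lemma L_eq {a b σ : ℝ} (h0 : 0 < σ) {v w : ℝ → ℝ}
    (hw0 : ∀ x, x ∉ Ioo a b → w x = 0) (hvw : ∀ᵐ x, x ∈ Ioo a b → v x = w x)
    {t : ℝ} (ht : t ∈ Ioo a b) :
    rlIntL a σ v t = (Real.Gamma σ)⁻¹ * ∫ s, kp σ (t - s) * w s := by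
  unfold rlIntL
  rw [if_neg h0.ne', intervalIntegral.integral_of_le ht.1.le, integral_Ioc_eq_integral_Ioo,
    ← integral_indicator measurableSet_Ioo]
  congr 1
  refine integral_congr_ae ?_
  filter_upwards [hvw] with s hs
  by_cases h : s ∈ Ioo a t
  · rw [indicator_of_mem h, kp_pos (by linarith [h.2]), hs ⟨h.1, h.2.trans ht.2⟩]
  · rw [indicator_of_notMem h]
    by_cases h' : a < s
    · rw [kp_neg, zero_mul]
      by_contra h3
      exact h ⟨h', by linarith⟩
    · rw [hw0 _ (fun h3 => h' h3.1), mul_zero]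

lemma R_eq {a b σ : ℝ} (h0 : 0 < σ) {v w : ℝ → ℝ}
    (hw0 : ∀ x, x ∉ Ioo a b → w x = 0) (hvw : ∀ᵐ x, x ∈ Ioo a b → v x = w x)
    {t : ℝ} (ht : t ∈ Ioo a b) :
    rlIntR b σ v t = (Real.Gamma σ)⁻¹ * ∫ s, kp σ (s - t) * w s := by
  unfold rlIntR
  rw [if_neg h0.ne', intervalIntegral.integral_of_le ht.2.le, integral_Ioc_eq_integral_Ioo,
    ← integral_indicator measurableSet_Ioo]
  congr 1
  refine integral_congr_ae ?_
  filter_upwards [hvw] with s hs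
  by_cases h : s ∈ Ioo t b
  · rw [indicator_of_mem h, kp_pos (by linarith [h.1]), hs ⟨ht.1.trans h.1, h.2⟩]
  · rw [indicator_of_notMem h]
    by_cases h' : s < b
    · rw [kp_neg, zero_mul]
      by_contra h3
      exact h ⟨by linarith, h'⟩
    · rw [hw0 _ (fun h3 => h' h3.2), mul_zero]

/-- Comparability of left and right Riemann–Liouville fractional integrals in `L²`,
with constant `sec(σπ)`. -/
theorem stmt7 (a b σ : ℝ) (hab : a < b) (hσ0 : 0 ≤ σ) (hσ : σ < 1 / 2)
    (v : ℝ → ℝ) (hv : MemLp v 2 (volume.restrict (Set.Ioo a b))) :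
    eLpNorm (rlIntR b σ v) 2 (volume.restrict (Set.Ioo a b)) ≤
      ENNReal.ofReal ((Real.cos (σ * Real.pi))⁻¹) *
        eLpNorm (rlIntL a σ v) 2 (volume.restrict (Set.Ioo a b)) ∧
    eLpNorm (rlIntL a σ v) 2 (volume.restrict (Set.Ioo a b)) ≤
      ENNReal.ofReal ((Real.cos (σ * Real.pi))⁻¹) *
        eLpNorm (rlIntR b σ v) 2 (volume.restrict (Set.Ioo a b)) := by
  rcases hσ0.eq_or_lt with h0 | h0
  · subst h0
    have e1 : rlIntR b 0 v = v := by ext t; simp [rlIntR]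
    have e2 : rlIntL a 0 v = v := by ext t; simp [rlIntL]
    simp [e1, e2]
  have hpi := Real.pi_pos
  have hc : 0 < Real.cos (σ * Real.pi) := Real.cos_pos_of_mem_Ioo ⟨by nlinarith, by nlinarith⟩
  set c := Real.cos (σ * Real.pi)
  have hg : 0 < Real.Gamma σ := Real.Gamma_pos_of_pos h0
  let w : ℝ → ℝ := (Ioo a b).indicator (hv.1.mk v)
  have hw : Measurable w := hv.1.stronglyMeasurable_mk.measurable.indicator measurableSet_Ioo
  have hw0 : ∀ x, x ∉ Ioo a b → w x = 0 := fun x hx => indicator_of_notMem hx _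
  have hvw : ∀ᵐ x, x ∈ Ioo a b → v x = w x := by
    have := hv.1.ae_eq_mk
    rw [Filter.EventuallyEq, ae_restrict_iff' measurableSet_Ioo] at this
    filter_upwards [this] with x hx hx'
    rw [hx hx']; exact (indicator_of_mem hx' _).symm
  have hw2 : Integrable (fun x => w x ^ 2) := by
    have h2 := (memLp_two_iff_integrable_sq hv.1).1 hv
    have h3 : IntegrableOn (fun x => w x ^ 2) (Ioo a b) := by
      refine h2.congr ?_
      filter_upwards [(ae_restrict_iff' measurableSet_Ioo).2 hvw] with x hx
      rw [hx]
    exact (integrableOn_iff_integrable_of_support_subset (fun x hx => by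
      by_contra h; exact hx (by simp [hw0 x h]))).1 h3
  obtain ⟨N, ⟨hF, hFN⟩, ⟨hG, hGN⟩, ⟨hFG, hFGN⟩⟩ := key h0 hσ hw hw0 hw2
  set F : ℝ → ℝ := fun t => ∫ s, kp σ (t - s) * w s with hFd
  set G : ℝ → ℝ := fun t => ∫ s, kp σ (s - t) * w s with hGd
  have hz : ∀ t, t ∉ Ioo a b → F t * G t = 0 := by
    intro t ht
    rcases le_or_gt t a with h | h
    · have : F t = 0 := by
        refine integral_eq_zero_of_ae (Filter.Eventually.of_forall fun s => ?_)
        simp only [Pi.zero_apply]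
        by_cases hs : s ∈ Ioo a b
        · rw [kp_neg (by linarith [hs.1]), zero_mul]
        · rw [hw0 s hs, mul_zero]
      rw [this, zero_mul]
    · have hb : b ≤ t := by by_contra h'; exact ht ⟨h, not_le.1 h'⟩
      have : G t = 0 := by
        refine integral_eq_zero_of_ae (Filter.Eventually.of_forall fun s => ?_)
        simp only [Pi.zero_apply]
        by_cases hs : s ∈ Ioo a b
        · rw [kp_neg (by linarith [hs.2]), zero_mul]
        · rw [hw0 s hs, mul_zero]
      rw [this, mul_zero]
  have r1 := real_ineq (a := a) (b := b) hc hF hG hGN hFG hFGN hz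
  have r2 := real_ineq (a := a) (b := b) hc hG hF hFN (by simpa only [mul_comm] using hFG)
    (by rw [← hFGN]; simp only [mul_comm]) (fun t ht => by rw [mul_comm]; exact hz t ht)
  have hF' : Integrable (fun t => (c⁻¹ * F t) ^ 2) := by
    simp_rw [mul_pow]; exact hF.const_mul _
  have hG' : Integrable (fun t => (c⁻¹ * G t) ^ 2) := by
    simp_rw [mul_pow]; exact hG.const_mul _
  have n1 := eLp_le hG.integrableOn hF'.integrableOn r1
  have n2 := eLp_le hF.integrableOn hG'.integrableOn r2
  have sm : ∀ (r : ℝ), 0 ≤ r → ∀ H : ℝ → ℝ, eLpNorm (fun t => r * H t) 2 (volume.restrict (Ioo a b)) =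
      ENNReal.ofReal r * eLpNorm H 2 (volume.restrict (Ioo a b)) := by
    intro r hr H
    have := eLpNorm_const_smul r H 2 (volume.restrict (Ioo a b))
    rw [Real.enorm_of_nonneg hr] at this
    exact this
  have eL : eLpNorm (rlIntL a σ v) 2 (volume.restrict (Ioo a b)) =
      ENNReal.ofReal (Real.Gamma σ)⁻¹ * eLpNorm F 2 (volume.restrict (Ioo a b)) := by
    rw [← sm _ (by positivity)]
    refine eLpNorm_congr_ae ?_
    filter_upwards [ae_restrict_mem measurableSet_Ioo] with t ht
    exact L_eq h0 hw0 hvw ht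
  have eR : eLpNorm (rlIntR b σ v) 2 (volume.restrict (Ioo a b)) =
      ENNReal.ofReal (Real.Gamma σ)⁻¹ * eLpNorm G 2 (volume.restrict (Ioo a b)) := by
    rw [← sm _ (by positivity)]
    refine eLpNorm_congr_ae ?_
    filter_upwards [ae_restrict_mem measurableSet_Ioo] with t ht
    exact R_eq h0 hw0 hvw ht
  rw [sm _ (by positivity)] at n1 n2
  rw [eL, eR, mul_left_comm, mul_left_comm (ENNReal.ofReal c⁻¹)]
  exact ⟨by gcongr, by gcongr⟩
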